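/- arXiv:1311.1595 — 4 statements merged into one kernel-verified Lean document; each statement's English description precedes it below -/
import Mathlib

section
/- There exists a constant C_d > 0 depending only on the dimension d with the following property. Let (Ω, 𝒜) be a measurable space, 𝒫 a nonempty set of probability measures on (Ω, 𝒜), and V_n, V : Ω → ℝ^d measurable maps. Let ε ∈ (0, 1], M ≥ 1 and L ≥ 1 be such that sup_{P∈𝒫} P{V ∉ (−M, M]^d} ≤ ε, and let f : ℝ^d → [−1, 1] be Lipschitz with constant L. Then sup_{P∈𝒫} |E_P f(V_n) − E_P f(V)| ≤ 4ε + C_d (1 + ML/ε)^d · sup_{P∈𝒫} sup_{t∈ℝ^d} |P{V_n ≤ t} − P{V ≤ t}|. -/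
open MeasureTheory

lemma box_diff {d : ℕ} (μ ν : Measure (Fin d → ℝ)) [IsProbabilityMeasure μ]
    [IsProbabilityMeasure ν] (b : ℝ)
    (hb : ∀ t, |μ.real (Set.Iic t) - ν.real (Set.Iic t)| ≤ b) (a c : Fin d → ℝ)
    (hac : ∀ j, a j ≤ c j) :
    |μ.real (Set.univ.pi fun j => Set.Ioc (a j) (c j))
      - ν.real (Set.univ.pi fun j => Set.Ioc (a j) (c j))| ≤ 2 ^ d * b := by
  classical
  let t : Finset (Fin d) → Fin d → ℝ := fun S j => if j ∈ S then a j else c j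
  have key : ∀ x : Fin d → ℝ,
      (Set.univ.pi fun j => Set.Ioc (a j) (c j)).indicator (fun _ => (1 : ℝ)) x
      = ∑ S ∈ (Finset.univ : Finset (Fin d)).powerset,
          (-1 : ℝ) ^ S.card * (Set.Iic (t S)).indicator (fun _ => (1 : ℝ)) x := by
    intro x
    have h1 : (Set.univ.pi fun j => Set.Ioc (a j) (c j)).indicator (fun _ => (1 : ℝ)) x
        = ∏ j, ((if x j ≤ c j then (1 : ℝ) else 0) - (if x j ≤ a j then (1 : ℝ) else 0)) := by
      have h2 : ∀ j, ((if x j ≤ c j then (1 : ℝ) else 0) - (if x j ≤ a j then (1 : ℝ) else 0))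
          = if x j ∈ Set.Ioc (a j) (c j) then 1 else 0 := by
        intro j
        have := hac j
        simp only [Set.mem_Ioc]
        split_ifs <;> first | (exfalso; grind) | norm_num
      simp only [h2, Finset.prod_ite_zero, Set.indicator_apply, Set.mem_pi]
      simp
    rw [h1, Finset.prod_sub]
    refine Finset.sum_congr rfl fun S _ => ?_
    rw [mul_assoc]
    congr 1
    rw [Finset.prod_ite_zero, Finset.prod_ite_zero]
    simp only [Set.indicator_apply, Set.mem_Iic, Pi.le_def, t]
    simp only [Finset.prod_const_one, ← ite_and, mul_ite, mul_one, mul_zero]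
    congr 1
    simp only [eq_iff_iff, Finset.mem_sdiff, Finset.mem_univ, true_and]
    grind
  have hm : ∀ (ρ : Measure (Fin d → ℝ)) [IsProbabilityMeasure ρ],
      ρ.real (Set.univ.pi fun j => Set.Ioc (a j) (c j))
      = ∑ S ∈ (Finset.univ : Finset (Fin d)).powerset,
          (-1 : ℝ) ^ S.card * ρ.real (Set.Iic (t S)) := by
    intro ρ _
    have hA : MeasurableSet (Set.univ.pi fun j => Set.Ioc (a j) (c j)) :=
      MeasurableSet.univ_pi fun j => measurableSet_Ioc
    have := integral_indicator_const (μ := ρ) (1 : ℝ) hA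
    simp only [smul_eq_mul, mul_one] at this
    rw [← this]
    simp_rw [key]
    rw [integral_finsetSum]
    · refine Finset.sum_congr rfl fun S _ => ?_
      rw [integral_const_mul, integral_indicator_const (1 : ℝ) measurableSet_Iic]
      simp
    · intro S _
      exact ((integrable_const (1 : ℝ)).indicator measurableSet_Iic).const_mul _
  rw [hm μ, hm ν, ← Finset.sum_sub_distrib]
  refine (Finset.abs_sum_le_sum_abs _ _).trans ?_
  refine (Finset.sum_le_card_nsmul _ _ b ?_).trans ?_
  · intro S _
    rw [← mul_sub, abs_mul, abs_pow]
    simpa using hb (t S)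
  · simp

lemma step_approx {d : ℕ} {ι : Type} [Fintype ι] (μ : Measure (Fin d → ℝ))
    [IsProbabilityMeasure μ] (f : (Fin d → ℝ) → ℝ) (hf : Measurable f)
    (hf1 : ∀ x, |f x| ≤ 1) (S : ι → Set (Fin d → ℝ)) (hS : ∀ k, MeasurableSet (S k))
    (hd : Pairwise (Function.onFun Disjoint S)) (y : ι → ℝ) (δ : ℝ) (hδ : 0 ≤ δ)
    (hy : ∀ k, ∀ x ∈ S k, |f x - y k| ≤ δ) :
    |∫ x, f x ∂μ - ∑ k, y k * μ.real (S k)| ≤ δ + μ.real (⋃ k, S k)ᶜ := by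
  have hQ : MeasurableSet (⋃ k, S k) := MeasurableSet.iUnion hS
  have hi : Integrable f μ := by
    refine Integrable.of_bound hf.aestronglyMeasurable 1 (ae_of_all _ ?_)
    simpa using hf1
  rw [← integral_add_compl hQ hi, integral_iUnion_fintype hS hd (fun k => hi.integrableOn)]
  have h1 : |∫ x in (⋃ k, S k)ᶜ, f x ∂μ| ≤ μ.real (⋃ k, S k)ᶜ := by
    have := norm_setIntegral_le_of_norm_le_const (μ := μ) (f := f) (s := (⋃ k, S k)ᶜ) (C := 1)
      (measure_lt_top _ _) (fun x _ => by simpa using hf1 x)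
    simpa using this
  have h2 : ∀ k, |∫ x in S k, f x ∂μ - y k * μ.real (S k)| ≤ δ * μ.real (S k) := by
    intro k
    have := norm_setIntegral_le_of_norm_le_const (μ := μ) (f := fun x => f x - y k) (s := S k)
      (C := δ) (measure_lt_top _ _) (fun x hx => by simpa using hy k x hx)
    rw [integral_sub hi.integrableOn (integrable_const _)] at this
    simpa [mul_comm] using this
  have h3 : |∑ k, ∫ x in S k, f x ∂μ - ∑ k, y k * μ.real (S k)| ≤ δ := by
    rw [← Finset.sum_sub_distrib]
    refine (Finset.abs_sum_le_sum_abs _ _).trans ((Finset.sum_le_sum fun k _ => h2 k).trans ?_)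
    rw [← Finset.mul_sum, ← measureReal_iUnion_fintype hd hS]
    exact mul_le_of_le_one_right hδ measureReal_le_one
  calc _ = |(∑ k, ∫ x in S k, f x ∂μ - ∑ k, y k * μ.real (S k))
        + ∫ x in (⋃ k, S k)ᶜ, f x ∂μ| := by congr 1; ring
    _ ≤ _ := (abs_add_le _ _).trans (add_le_add h3 h1)

lemma core {d : ℕ} (μ ν : Measure (Fin d → ℝ)) [IsProbabilityMeasure μ]
    [IsProbabilityMeasure ν] (b : ℝ)
    (hb : ∀ t, |μ.real (Set.Iic t) - ν.real (Set.Iic t)| ≤ b)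
    (ε M L : ℝ) (hε : 0 < ε) (hM : 1 ≤ M) (hL : 1 ≤ L)
    (hν : ν.real (Set.univ.pi fun _ => Set.Ioc (-M) M)ᶜ ≤ ε)
    (f : (Fin d → ℝ) → ℝ) (hf : LipschitzWith (Real.toNNReal L) f) (hf1 : ∀ x, |f x| ≤ 1) :
    |∫ x, f x ∂μ - ∫ x, f x ∂ν| ≤ 4 * ε + (2 ^ d + 4 ^ d) * (1 + M * L / ε) ^ d * b := by
  have hb0 : 0 ≤ b := (abs_nonneg _).trans (hb 0)
  have hR : 0 < 2 * M * L / ε := by positivity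
  set N := ⌈2 * M * L / ε⌉₊ with hN
  have hN1 : 2 * M * L / ε ≤ N := Nat.le_ceil _
  have hN2 : (N : ℝ) < 2 * M * L / ε + 1 := Nat.ceil_lt_add_one hR.le
  have hNpos : (0 : ℝ) < N := hR.trans_le hN1
  set h : ℝ := 2 * M / N with hh
  have hpos : 0 < h := by positivity
  have hNh : N * h = 2 * M := by rw [hh]; field_simp
  have hLh : L * h ≤ ε := by
    rw [div_le_iff₀ hε] at hN1
    rw [hh, mul_div_assoc', div_le_iff₀ hNpos]
    linarith
  let A : (Fin d → Fin N) → Fin d → ℝ := fun k j => -M + (k j : ℕ) * h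
  let B : (Fin d → Fin N) → Fin d → ℝ := fun k j => -M + ((k j : ℕ) + 1) * h
  let S : (Fin d → Fin N) → Set (Fin d → ℝ) :=
    fun k => Set.univ.pi fun j => Set.Ioc (A k j) (B k j)
  have hS : ∀ k, MeasurableSet (S k) := fun k => MeasurableSet.univ_pi fun j => measurableSet_Ioc
  have hlt : ∀ (m n : ℕ) (x : ℝ), -M + m * h < x → x ≤ -M + (n + 1) * h → m ≤ n := by
    intro m n x h1 h2
    by_contra! hc
    have : ((n : ℝ) + 1) ≤ m := by exact_mod_cast hc
    have := mul_le_mul_of_nonneg_right this hpos.le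
    linarith
  have hd : Pairwise (Function.onFun Disjoint S) := by
    intro k k' hk
    refine Set.disjoint_left.2 fun x hx hx' => hk ?_
    funext j
    have h1 := hx j trivial
    have h2 := hx' j trivial
    exact Fin.ext (le_antisymm (hlt _ _ _ h1.1 h2.2) (hlt _ _ _ h2.1 h1.2))
  have hU : (⋃ k, S k) = Set.univ.pi fun _ => Set.Ioc (-M) M := by
    ext x
    simp only [Set.mem_iUnion]
    constructor
    · rintro ⟨k, hk⟩ j _
      have h1 := hk j trivial
      have h2 : ((k j : ℕ) : ℝ) + 1 ≤ N := by exact_mod_cast (k j).2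
      have h3 := mul_le_mul_of_nonneg_right h2 hpos.le
      have h4 : 0 ≤ ((k j : ℕ) : ℝ) * h := by positivity
      simp only [A, B, Set.mem_Ioc] at h1
      constructor <;> linarith [h1.1, h1.2]
    · intro hx
      have : ∀ j, ∃ m : Fin N, -M + (m : ℕ) * h < x j ∧ x j ≤ -M + ((m : ℕ) + 1) * h := by
        intro j
        obtain ⟨h1, h2⟩ := hx j trivial
        have hq : 0 < (x j + M) / h := div_pos (by linarith) hpos
        have hc := Nat.ceil_pos.2 hq
        obtain ⟨m, hm⟩ := Nat.exists_eq_succ_of_ne_zero hc.ne'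
        have h3 := Nat.le_ceil ((x j + M) / h)
        have h4 := Nat.ceil_lt_add_one hq.le
        have h5 : ⌈(x j + M) / h⌉₊ ≤ N := by
          apply Nat.ceil_le.2
          rw [div_le_iff₀ hpos]
          linarith
        rw [hm] at h3 h4 h5
        push_cast at h3 h4
        rw [div_le_iff₀ hpos] at h3
        have h6 : (m : ℝ) < (x j + M) / h := by linarith
        rw [lt_div_iff₀ hpos] at h6
        exact ⟨⟨m, h5⟩, by simp only; linarith, by simp only; linarith⟩
      choose k hk using this
      exact ⟨k, fun j _ => hk j⟩
  have hy : ∀ k, ∀ x ∈ S k, |f x - f (A k)| ≤ ε := by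
    intro k x hx
    have h1 := hf.dist_le_mul x (A k)
    rw [Real.dist_eq, Real.coe_toNNReal _ (by linarith)] at h1
    refine h1.trans (le_trans (mul_le_mul_of_nonneg_left ?_ (by linarith)) hLh)
    refine (dist_pi_le_iff hpos.le).2 fun j => ?_
    have h2 := hx j trivial
    simp only [A, B, Set.mem_Ioc] at h2
    rw [Real.dist_eq, abs_le]
    simp only [A]
    constructor <;> linarith [h2.1, h2.2]
  have e1 := step_approx μ f hf.continuous.measurable hf1 S hS hd (fun k => f (A k)) ε hε.le hy
  have e2 := step_approx ν f hf.continuous.measurable hf1 S hS hd (fun k => f (A k)) ε hε.le hy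
  have hQ : MeasurableSet (Set.univ.pi fun _ : Fin d => Set.Ioc (-M) M) :=
    MeasurableSet.univ_pi fun j => measurableSet_Ioc
  rw [hU] at e1 e2
  have e3 := box_diff μ ν b hb (fun _ => -M) (fun _ => M) (fun _ => by linarith)
  have e4 : μ.real (Set.univ.pi fun _ : Fin d => Set.Ioc (-M) M)ᶜ ≤ ε + 2 ^ d * b := by
    rw [probReal_compl_eq_one_sub hQ] at hν ⊢
    linarith [(abs_le.1 e3).1]
  have e5 : |∑ k, f (A k) * μ.real (S k) - ∑ k, f (A k) * ν.real (S k)|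
      ≤ (N : ℝ) ^ d * (2 ^ d * b) := by
    rw [← Finset.sum_sub_distrib]
    refine (Finset.abs_sum_le_sum_abs _ _).trans ?_
    refine (Finset.sum_le_card_nsmul _ _ (2 ^ d * b) ?_).trans ?_
    · intro k _
      rw [← mul_sub, abs_mul]
      have := box_diff μ ν b hb (A k) (B k) (fun j => by simp only [A, B]; linarith)
      exact (mul_le_of_le_one_left (abs_nonneg _) (hf1 _)).trans this
    · simp
  have hK : 0 ≤ M * L / ε := by positivity
  have hN3 : (N : ℝ) ≤ 2 * (1 + M * L / ε) := by
    have : 2 * M * L / ε = 2 * (M * L / ε) := by ring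
    linarith
  have e6 : (N : ℝ) ^ d * (2 ^ d * b) ≤ 4 ^ d * (1 + M * L / ε) ^ d * b := by
    calc (N : ℝ) ^ d * (2 ^ d * b) ≤ (2 * (1 + M * L / ε)) ^ d * (2 ^ d * b) := by gcongr
      _ = _ := by
        rw [mul_pow, show (4 : ℝ) = 2 * 2 by norm_num, mul_pow]; ring
  have e7 : 2 ^ d * b ≤ 2 ^ d * (1 + M * L / ε) ^ d * b := by
    have : 1 ≤ (1 + M * L / ε) ^ d := one_le_pow₀ (by linarith)
    have h2 : 0 ≤ (2 : ℝ) ^ d * b := by positivity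
    nlinarith
  rw [abs_le] at *
  constructor <;> linarith [e1.1, e1.2, e2.1, e2.2, e5.1, e5.2]



/-- There is a constant `C_d > 0` depending only on `d` such that: for any
family `𝒫` of probability measures, measurable `V_n, V : Ω → ℝ^d`, `ε ∈ (0,1]`, `M, L ≥ 1`
with `sup_P P{V ∉ (−M,M]^d} ≤ ε`, any `L`-Lipschitz `f : ℝ^d → [−1,1]`, and any upper bound
`b` of the CDF differences `|P{V_n ≤ t} − P{V ≤ t}|` (in particular their supremum), one has
`|E_P f(V_n) − E_P f(V)| ≤ 4ε + C_d (1 + M L / ε)^d · b` for every `P ∈ 𝒫`. -/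
theorem statement2 (d : ℕ) :
    ∃ C : ℝ, 0 < C ∧
      ∀ (Ω : Type) [MeasurableSpace Ω] (Ps : Set (Measure Ω)),
        Ps.Nonempty → (∀ P ∈ Ps, IsProbabilityMeasure P) →
        ∀ Vn V : Ω → Fin d → ℝ, Measurable Vn → Measurable V →
        ∀ ε M L : ℝ, 0 < ε → ε ≤ 1 → 1 ≤ M → 1 ≤ L →
        (∀ P ∈ Ps, (P {ω | ¬ ∀ j, -M < V ω j ∧ V ω j ≤ M}).toReal ≤ ε) →
        ∀ f : (Fin d → ℝ) → ℝ, LipschitzWith (Real.toNNReal L) f →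
        (∀ x, f x ∈ Set.Icc (-1 : ℝ) 1) →
        ∀ b : ℝ,
          (∀ P ∈ Ps, ∀ t : Fin d → ℝ,
            |(P {ω | ∀ j, Vn ω j ≤ t j}).toReal - (P {ω | ∀ j, V ω j ≤ t j}).toReal| ≤ b) →
        ∀ P ∈ Ps,
          |(∫ ω, f (Vn ω) ∂P) - ∫ ω, f (V ω) ∂P| ≤
            4 * ε + C * (1 + M * L / ε) ^ d * b := by
  refine ⟨2 ^ d + 4 ^ d, by positivity, ?_⟩
  intro Ω _ Ps _ hPs Vn V hVn hV ε M L hε _ hM hL hP f hf hf1 b hb P hPP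
  have := hPs P hPP
  have := Measure.isProbabilityMeasure_map (μ := P) hVn.aemeasurable
  have := Measure.isProbabilityMeasure_map (μ := P) hV.aemeasurable
  have hQ : MeasurableSet (Set.univ.pi fun _ : Fin d => Set.Ioc (-M) M) :=
    MeasurableSet.univ_pi fun j => measurableSet_Ioc
  have := core (P.map Vn) (P.map V) b (fun t => by
      rw [map_measureReal_apply hVn measurableSet_Iic, map_measureReal_apply hV measurableSet_Iic]
      exact hb P hPP t) ε M L hε hM hL (by
      rw [map_measureReal_apply hV hQ.compl]
      have hE : V ⁻¹' (Set.univ.pi fun _ : Fin d => Set.Ioc (-M) M)ᶜ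
          = {ω | ¬ ∀ j, -M < V ω j ∧ V ω j ≤ M} := by
        ext ω
        simp [Set.mem_pi]
      rw [hE]
      exact hP P hPP) f hf (fun x => abs_le.2 (hf1 x))
  rwa [integral_map hVn.aemeasurable hf.continuous.aestronglyMeasurable,
    integral_map hV.aemeasurable hf.continuous.aestronglyMeasurable] at this
end

section
/- Let (Ω, 𝒜) be a measurable space, 𝒫 a nonempty set of probability measures on (Ω, 𝒜), and V_n, V : Ω → ℝ^d measurable maps (n = 1, 2, …). Suppose (a) the family {P ∘ V^{−1} : P ∈ 𝒫} is uniformly tight, and (b) sup_{P∈𝒫} sup_{t∈ℝ^d} |P{V_n ≤ t} − P{V ≤ t}| → 0 as n → ∞. Then for every bounded continuous function f : ℝ^d → ℝ, sup_{P∈𝒫} |E_P f(V_n) − E_P f(V)| → 0 as n → ∞. -/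
open MeasureTheory

/-- bounded measurable functions for which uniform convergence holds -/
def GoodFn {Ω : Type*} [MeasurableSpace Ω] (Ps : Set (Measure Ω)) {d : ℕ}
    (Vn : ℕ → Ω → Fin d → ℝ) (V : Ω → Fin d → ℝ) (g : (Fin d → ℝ) → ℝ) : Prop :=
  Measurable g ∧ (∃ B : ℝ, ∀ x, |g x| ≤ B) ∧
    ∀ ε > (0 : ℝ), ∃ n₀ : ℕ, ∀ n ≥ n₀, ∀ P ∈ Ps,
      |(∫ ω, g (Vn n ω) ∂P) - ∫ ω, g (V ω) ∂P| ≤ ε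

theorem bdd_int {Ω : Type*} [MeasurableSpace Ω] (P : Measure Ω) [IsProbabilityMeasure P] {d : ℕ}
    {U : Ω → Fin d → ℝ} (hU : Measurable U) {g : (Fin d → ℝ) → ℝ} (hg : Measurable g)
    (hb : ∃ B : ℝ, ∀ x, |g x| ≤ B) : Integrable (fun ω => g (U ω)) P := by
  obtain ⟨B, hB⟩ := hb
  exact Integrable.of_bound (hg.comp hU).aestronglyMeasurable B
    (Filter.Eventually.of_forall fun ω => hB _)

section
variable {Ω : Type*} [MeasurableSpace Ω] {Ps : Set (Measure Ω)}
    (hprob : ∀ P ∈ Ps, IsProbabilityMeasure P) {d : ℕ}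
    {Vn : ℕ → Ω → Fin d → ℝ} {V : Ω → Fin d → ℝ}
    (hVn : ∀ n, Measurable (Vn n)) (hV : Measurable V)

theorem GoodFn.smul_add (hprob : ∀ P ∈ Ps, IsProbabilityMeasure P)
    (hVn : ∀ n, Measurable (Vn n)) (hV : Measurable V) {g h : (Fin d → ℝ) → ℝ}
    (hg : GoodFn Ps Vn V g) (hh : GoodFn Ps Vn V h) (c : ℝ) :
    GoodFn Ps Vn V (fun x => g x + c * h x) := by
  obtain ⟨mg, ⟨Bg, bg⟩, cg⟩ := hg
  obtain ⟨mh, ⟨Bh, bh⟩, ch⟩ := hh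
  refine ⟨mg.add (mh.const_mul c), ⟨Bg + |c| * Bh, fun x => ?_⟩, ?_⟩
  · refine (abs_add_le _ _).trans (add_le_add (bg x) ?_)
    rw [abs_mul]
    exact mul_le_mul_of_nonneg_left (bh x) (abs_nonneg c)
  · intro ε hε
    have hc : 0 < 1 + |c| := by positivity
    obtain ⟨n1, h1⟩ := cg (ε / 2) (by positivity)
    obtain ⟨n2, h2⟩ := ch (ε / (2 * (1 + |c|))) (by positivity)
    refine ⟨max n1 n2, fun n hn P hP => ?_⟩
    have := hprob P hP
    have e : ∀ U : Ω → Fin d → ℝ, Measurable U → (∫ ω, (g (U ω) + c * h (U ω)) ∂P)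
        = (∫ ω, g (U ω) ∂P) + c * ∫ ω, h (U ω) ∂P := by
      intro U hU
      rw [integral_add (bdd_int P hU mg ⟨Bg, bg⟩) ((bdd_int P hU mh ⟨Bh, bh⟩).const_mul c),
        integral_const_mul]
    rw [e _ (hVn n), e _ hV]
    have a1 := h1 n (le_of_max_le_left hn) P hP
    have a2 := h2 n (le_of_max_le_right hn) P hP
    have a3 : |c| * |(∫ ω, h (Vn n ω) ∂P) - ∫ ω, h (V ω) ∂P| ≤ ε / 2 := by
      calc _ ≤ (1 + |c|) * (ε / (2 * (1 + |c|))) := by gcongr; linarith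
        _ = ε / 2 := by field_simp
    rw [← abs_mul] at a3
    calc _ = |((∫ ω, g (Vn n ω) ∂P) - ∫ ω, g (V ω) ∂P)
          + c * ((∫ ω, h (Vn n ω) ∂P) - ∫ ω, h (V ω) ∂P)| := by ring_nf
      _ ≤ _ := abs_add_le _ _
      _ ≤ ε := by linarith

theorem GoodFn.sum (hprob : ∀ P ∈ Ps, IsProbabilityMeasure P)
    (hVn : ∀ n, Measurable (Vn n)) (hV : Measurable V) {ι : Type*} (s : Finset ι)
    (c : ι → ℝ) (g : ι → (Fin d → ℝ) → ℝ) (hg : ∀ i, GoodFn Ps Vn V (g i)) :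
    GoodFn Ps Vn V (fun x => ∑ i ∈ s, c i * g i x) := by
  classical
  induction s using Finset.induction_on with
  | empty =>
    simp only [Finset.sum_empty]
    exact ⟨measurable_const, ⟨0, by simp⟩, fun ε hε => ⟨0, fun n _ P _ => by simpa using hε.le⟩⟩
  | insert i s hi ih =>
    have := GoodFn.smul_add hprob hVn hV ih (hg i) (c i)
    refine (congrArg (GoodFn Ps Vn V) ?_).mp this
    funext x
    rw [Finset.sum_insert hi, add_comm]

def hbox {d : ℕ} (S : Finset (Fin d)) (a b : Fin d → ℝ) : Set (Fin d → ℝ) :=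
  {x | ∀ j, x j ≤ b j ∧ (j ∈ S → a j < x j)}

theorem good_hbox (hprob : ∀ P ∈ Ps, IsProbabilityMeasure P)
    (hVn : ∀ n, Measurable (Vn n)) (hV : Measurable V)
    (hcdf : ∀ ε > (0 : ℝ), ∃ n₀ : ℕ, ∀ n ≥ n₀, ∀ P ∈ Ps, ∀ t : Fin d → ℝ,
      |(P {ω | ∀ j, Vn n ω j ≤ t j}).toReal - (P {ω | ∀ j, V ω j ≤ t j}).toReal| ≤ ε)
    (a : Fin d → ℝ) (S : Finset (Fin d)) : ∀ b : Fin d → ℝ,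
    GoodFn Ps Vn V ((hbox S a b).indicator (fun _ => (1 : ℝ))) := by
  classical
  induction S using Finset.induction_on with
  | empty =>
    intro b
    have hm : MeasurableSet (hbox ∅ a b) := by
      have : hbox ∅ a b = Set.Iic b := by ext x; simp [hbox, Pi.le_def]
      rw [this]; exact measurableSet_Iic
    refine ⟨measurable_const.indicator hm, ⟨1, fun x => ?_⟩, fun ε hε => ?_⟩
    · by_cases hx : x ∈ hbox ∅ a b <;> simp [hx]
    · obtain ⟨n0, h0⟩ := hcdf ε hε
      refine ⟨n0, fun n hn P hP => ?_⟩
      have e : ∀ U : Ω → Fin d → ℝ, Measurable U →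
          (∫ ω, (hbox ∅ a b).indicator (fun _ => (1 : ℝ)) (U ω) ∂P)
          = (P {ω | ∀ j, U ω j ≤ b j}).toReal := by
        intro U hU
        have h1 : (fun ω => (hbox ∅ a b).indicator (fun _ => (1 : ℝ)) (U ω))
            = (U ⁻¹' (hbox ∅ a b)).indicator 1 := by
          funext ω; rfl
        rw [h1, integral_indicator_one (hU hm)]
        simp [hbox, Measure.real, Set.preimage]
      rw [e _ (hVn n), e _ hV]
      exact h0 n hn P hP b
  | insert i S hi ih =>
    intro b
    have := GoodFn.smul_add hprob hVn hV (ih b)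
      (ih (Function.update b i (min (a i) (b i)))) (-1)
    refine (congrArg (GoodFn Ps Vn V) ?_).mp this
    funext x
    have key1 : x ∈ hbox (insert i S) a b ↔ x ∈ hbox S a b ∧ a i < x i := by
      simp only [hbox, Set.mem_setOf_eq, Finset.mem_insert]
      constructor
      · intro h
        exact ⟨fun j => ⟨(h j).1, fun hj => (h j).2 (Or.inr hj)⟩, (h i).2 (Or.inl rfl)⟩
      · rintro ⟨h, h'⟩ j
        refine ⟨(h j).1, ?_⟩
        rintro (rfl | hj)
        · exact h'
        · exact (h j).2 hj
    have key2 : x ∈ hbox S a (Function.update b i (min (a i) (b i))) ↔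
        x ∈ hbox S a b ∧ x i ≤ a i := by
      simp only [hbox, Set.mem_setOf_eq]
      constructor
      · intro h
        have hi' := (h i).1
        simp at hi'
        refine ⟨fun j => ⟨?_, (h j).2⟩, hi'.1⟩
        by_cases hj : j = i
        · subst hj; exact hi'.2
        · simpa [hj] using (h j).1
      · rintro ⟨h, h'⟩ j
        refine ⟨?_, (h j).2⟩
        by_cases hj : j = i
        · subst hj; simp [h', (h j).1]
        · simpa [hj] using (h j).1
    simp only [Set.indicator_apply, key1, key2]
    by_cases h1 : x ∈ hbox S a b <;> by_cases h2 : a i < x i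
    · simp [h1, h2, not_le.mpr h2]
    · simp [h1, h2, not_lt.mp h2]
    · simp [h1]
    · simp [h1]
end

/-- If the laws of `V` under `P ∈ 𝒫` are uniformly tight, and the multivariate
CDFs of `V_n` converge to those of `V` uniformly over `t ∈ ℝ^d` and `P ∈ 𝒫`, then for every
bounded continuous `f : ℝ^d → ℝ`, `sup_{P∈𝒫} |E_P f(V_n) − E_P f(V)| → 0` as `n → ∞`. -/
theorem statement3 {Ω : Type*} [MeasurableSpace Ω] (Ps : Set (Measure Ω)) (hPs : Ps.Nonempty)
    (hprob : ∀ P ∈ Ps, IsProbabilityMeasure P) {d : ℕ}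
    (Vn : ℕ → Ω → Fin d → ℝ) (V : Ω → Fin d → ℝ)
    (hVn : ∀ n, Measurable (Vn n)) (hV : Measurable V)
    (htight : ∀ ε > (0 : ℝ), ∃ K : Set (Fin d → ℝ), IsCompact K ∧
      ∀ P ∈ Ps, (P {ω | V ω ∉ K}).toReal < ε)
    (hcdf : ∀ ε > (0 : ℝ), ∃ n₀ : ℕ, ∀ n ≥ n₀, ∀ P ∈ Ps, ∀ t : Fin d → ℝ,
      |(P {ω | ∀ j, Vn n ω j ≤ t j}).toReal - (P {ω | ∀ j, V ω j ≤ t j}).toReal| ≤ ε)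
    (f : (Fin d → ℝ) → ℝ) (hf : Continuous f) (hfb : ∃ B : ℝ, ∀ x, |f x| ≤ B) :
    ∀ ε > (0 : ℝ), ∃ n₀ : ℕ, ∀ n ≥ n₀, ∀ P ∈ Ps,
      |(∫ ω, f (Vn n ω) ∂P) - ∫ ω, f (V ω) ∂P| ≤ ε := by
  classical
  intro ε hε
  obtain ⟨B, hB⟩ := hfb
  have hB0 : 0 ≤ B := (abs_nonneg _).trans (hB 0)
  obtain ⟨e, he, hee⟩ : ∃ e > 0, 3 * e * (1 + B) = ε :=
    ⟨ε / (3 * (1 + B)), by positivity, by field_simp⟩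
  obtain ⟨K, hK, hKP⟩ := htight e he
  obtain ⟨M0, hM0⟩ := hK.isBounded.exists_norm_le
  obtain ⟨M, hM, hM1⟩ : ∃ M : ℝ, (∀ x ∈ K, ‖x‖ ≤ M) ∧ 0 ≤ M :=
    ⟨max M0 0, fun x hx => (hM0 x hx).trans (le_max_left _ _), le_max_right _ _⟩
  set C : Set (Fin d → ℝ) := Set.Icc (fun _ => -(M + 2)) (fun _ => M + 2) with hC
  have hCc : IsCompact C := isCompact_Icc
  have huc := hCc.uniformContinuousOn_of_continuous hf.continuousOn
  rw [Metric.uniformContinuousOn_iff] at huc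
  obtain ⟨δ0, hδ0, huc⟩ := huc e he
  obtain ⟨δ, hδ, hδ1, hδd⟩ : ∃ δ : ℝ, 0 < δ ∧ δ ≤ 1 ∧ δ < δ0 :=
    ⟨min 1 (δ0 / 2), by positivity, min_le_left _ _, (min_le_right _ _).trans_lt (by linarith)⟩
  obtain ⟨m, hm1, hm2⟩ : ∃ m : ℤ, M < δ * m ∧ δ * m ≤ M + 2 := by
    refine ⟨⌊M / δ⌋ + 1, ?_, ?_⟩
    · have := Int.lt_floor_add_one (M / δ)
      rw [div_lt_iff₀ hδ] at this
      push_cast; linarith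
    · have := Int.floor_le (M / δ)
      rw [le_div_iff₀ hδ] at this
      push_cast; linarith
  set G : Finset (Fin d → ℤ) := Fintype.piFinset (fun _ => Finset.Ioc (-m) m) with hG
  set cell : (Fin d → ℤ) → Set (Fin d → ℝ) := fun k =>
    hbox Finset.univ (fun j => δ * (k j - 1)) (fun j => δ * k j) with hcell
  set Q : Set (Fin d → ℝ) := hbox Finset.univ (fun _ => -(δ * m)) (fun _ => δ * m) with hQ
  set q : (Fin d → ℝ) → ℝ := Q.indicator (fun _ => (1 : ℝ)) with hq
  set h : (Fin d → ℝ) → ℝ := fun x =>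
    ∑ k ∈ G, f (fun j => δ * k j) * (cell k).indicator (fun _ => (1 : ℝ)) x with hh
  have gq : GoodFn Ps Vn V q := good_hbox hprob hVn hV hcdf _ _ _
  have gh : GoodFn Ps Vn V h := GoodFn.sum hprob hVn hV G _ _
    (fun k => good_hbox hprob hVn hV hcdf _ _ _)
  have cellmem : ∀ x k, x ∈ cell k ↔ ∀ j, ⌈x j / δ⌉ = k j := by
    intro x k
    simp only [hcell, hbox, Set.mem_setOf_eq, Finset.mem_univ, forall_true_left]
    refine forall_congr' fun j => ?_
    rw [Int.ceil_eq_iff, lt_div_iff₀ hδ, div_le_iff₀ hδ, and_comm, mul_comm δ, mul_comm δ]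
  have Gmem : ∀ x : Fin d → ℝ, (fun j => ⌈x j / δ⌉) ∈ G ↔ x ∈ Q := by
    intro x
    simp only [hG, hQ, hbox, Fintype.mem_piFinset, Finset.mem_Ioc, Set.mem_setOf_eq,
      Finset.mem_univ, forall_true_left]
    refine forall_congr' fun j => ?_
    rw [Int.lt_ceil, Int.ceil_le, lt_div_iff₀ hδ, div_le_iff₀ hδ, and_comm, mul_comm δ]
    push_cast
    rw [neg_mul]
  have hval : ∀ x, x ∈ Q → h x = f (fun j => δ * ⌈x j / δ⌉) := by
    intro x hx
    simp only [hh]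
    rw [Finset.sum_eq_single (fun j => ⌈x j / δ⌉)]
    · rw [Set.indicator_of_mem ((cellmem _ _).2 fun j => rfl), mul_one]
    · intro k _ hk
      rw [Set.indicator_of_notMem, mul_zero]
      intro hc
      exact hk (funext fun j => ((cellmem _ _).1 hc j).symm)
    · intro hn
      exact absurd ((Gmem x).2 hx) hn
  have hval0 : ∀ x, x ∉ Q → h x = 0 := by
    intro x hx
    refine Finset.sum_eq_zero fun k hk => ?_
    rw [Set.indicator_of_notMem, mul_zero]
    intro hc
    have : (fun j => ⌈x j / δ⌉) = k := funext fun j => (cellmem _ _).1 hc j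
    exact hx ((Gmem x).1 (this ▸ hk))
  have hQC : ∀ x ∈ Q, x ∈ C := by
    intro x hx
    refine ⟨fun j => ?_, fun j => ?_⟩
    · have := (hx j).2 (Finset.mem_univ j)
      simp only at this ⊢
      linarith
    · have := (hx j).1
      simp only at this ⊢
      linarith
  have hpt : ∀ x, |f x - h x| ≤ e + B * (1 - q x) := by
    intro x
    by_cases hx : x ∈ Q
    · have hq1 : q x = 1 := Set.indicator_of_mem hx _
      rw [hq1, hval x hx]
      have hkG := (Gmem x).2 hx
      have hC2 : (fun j => δ * (⌈x j / δ⌉ : ℝ)) ∈ C := by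
        apply hQC
        intro j
        have := Finset.mem_Ioc.1 (Fintype.mem_piFinset.1 hkG j)
        have h1 : -(m : ℝ) < (⌈x j / δ⌉ : ℝ) := by exact_mod_cast this.1
        have h2 : (⌈x j / δ⌉ : ℝ) ≤ m := by exact_mod_cast this.2
        refine ⟨?_, fun _ => ?_⟩
        · exact mul_le_mul_of_nonneg_left h2 hδ.le
        · have := mul_lt_mul_of_pos_left h1 hδ
          simp only
          linarith
      have hd : dist x (fun j => δ * (⌈x j / δ⌉ : ℝ)) < δ0 := by
        refine lt_of_le_of_lt ((dist_pi_le_iff hδ.le).2 fun j => ?_) hδd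
        have h1 := Int.le_ceil (x j / δ)
        have h2 := Int.ceil_lt_add_one (x j / δ)
        rw [div_le_iff₀ hδ] at h1
        have h3 := mul_lt_mul_of_pos_left h2 hδ
        rw [mul_add, mul_div_cancel₀ _ hδ.ne'] at h3
        rw [Real.dist_eq, abs_le]
        constructor <;> linarith
      have := huc x (hQC x hx) _ hC2 hd
      rw [Real.dist_eq] at this
      linarith
    · have hq1 : q x = 0 := Set.indicator_of_notMem hx _
      rw [hq1, hval0 x hx]
      have := hB x
      simp only [sub_zero, mul_one]
      linarith
  have hfm := hf.measurable
  have est : ∀ P ∈ Ps, ∀ U : Ω → Fin d → ℝ, Measurable U →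
      |(∫ ω, f (U ω) ∂P) - ∫ ω, h (U ω) ∂P| ≤ e + B * (1 - ∫ ω, q (U ω) ∂P) := by
    intro P hP U hU
    have := hprob P hP
    have If := bdd_int P hU hfm ⟨B, hB⟩
    have Ih := bdd_int P hU gh.1 gh.2.1
    have Iq := bdd_int P hU gq.1 gq.2.1
    have I1 : Integrable (fun ω => 1 - q (U ω)) P := (integrable_const 1).sub Iq
    rw [← integral_sub If Ih]
    calc _ ≤ ∫ ω, |f (U ω) - h (U ω)| ∂P := abs_integral_le_integral_abs
      _ ≤ ∫ ω, (e + B * (1 - q (U ω))) ∂P :=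
        integral_mono (If.sub Ih).abs ((integrable_const e).add (I1.const_mul B))
          (fun ω => hpt _)
      _ = _ := by
        rw [integral_add (integrable_const e) (I1.const_mul B), integral_const_mul,
          integral_sub (integrable_const 1) Iq]
        simp
  have hqV : ∀ P ∈ Ps, 1 - ∫ ω, q (V ω) ∂P ≤ e := by
    intro P hP
    have := hprob P hP
    have hKm : MeasurableSet (V ⁻¹' K) := hV hK.measurableSet
    have h1 : P.real (V ⁻¹' K) ≤ ∫ ω, q (V ω) ∂P := by
      rw [← integral_indicator_one hKm]
      refine integral_mono ((integrable_const (1 : ℝ)).indicator hKm)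
        (bdd_int P hV gq.1 gq.2.1) (fun ω => ?_)
      by_cases hω : V ω ∈ K
      · have hωQ : V ω ∈ Q := by
          intro j
          have := abs_le.1 ((norm_le_pi_norm (V ω) j).trans (hM _ hω))
          exact ⟨by simp only; linarith [this.2], fun _ => by simp only; linarith [this.1]⟩
        simp [hq, Set.indicator_apply, hω, hωQ]
      · simp only [Set.indicator_apply, Set.mem_preimage, hω, if_false, hq]
        split_ifs <;> norm_num
    have h2 := hKP P hP
    have h3 : P.real (V ⁻¹' K)ᶜ = 1 - P.real (V ⁻¹' K) := probReal_compl_eq_one_sub hKm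
    have h4 : (P {ω | V ω ∉ K}).toReal = P.real (V ⁻¹' K)ᶜ := rfl
    linarith
  obtain ⟨n1, h1⟩ := gq.2.2 e he
  obtain ⟨n2, h2⟩ := gh.2.2 e he
  refine ⟨max n1 n2, fun n hn P hP => ?_⟩
  have a1 := abs_le.1 (h1 n (le_of_max_le_left hn) P hP)
  have a2 := abs_le.1 (h2 n (le_of_max_le_right hn) P hP)
  have a3 := abs_le.1 (est P hP _ (hVn n))
  have a4 := abs_le.1 (est P hP _ hV)
  have a5 := hqV P hP
  have a6 : B * (1 - ∫ ω, q (Vn n ω) ∂P) ≤ B * (2 * e) :=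
    mul_le_mul_of_nonneg_left (by linarith [a1.1]) hB0
  have a7 : B * (1 - ∫ ω, q (V ω) ∂P) ≤ B * e := mul_le_mul_of_nonneg_left a5 hB0
  have a8 : ε = 3 * e + 3 * (B * e) := by rw [← hee]; ring
  rw [abs_le]
  constructor
  · linarith [a2.1, a3.1, a4.2]
  · linarith [a2.2, a3.2, a4.1]
end

section
/- Let (Ω, 𝒜) be a measurable space, 𝒫 a nonempty set of probability measures on (Ω, 𝒜), and V_n, V : Ω → ℝ^d measurable maps (n = 1, 2, …). Suppose sup_{P∈𝒫} E_P‖V‖² < ∞ and for each t ∈ ℝ^d, sup_{P∈𝒫} |P{V_n ≤ t} − P{V ≤ t}| → 0 as n → ∞. Then for every ε > 0 there exist a compact set K ⊆ ℝ^d and n₀ ∈ ℕ such that for all n ≥ n₀, sup_{P∈𝒫} P{V_n ∉ K} < ε. -/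
open MeasureTheory

/-- If `sup_{P∈𝒫} E_P ‖V‖² < ∞` and for each `t ∈ ℝ^d` the multivariate CDFs
of `V_n` converge to those of `V` at `t` uniformly over `P ∈ 𝒫`, then the laws of `V_n` are
eventually uniformly tight, uniformly over `𝒫`: for every `ε > 0` there are a compact
`K ⊆ ℝ^d` and `n₀` with `sup_{P∈𝒫} P{V_n ∉ K} < ε` for all `n ≥ n₀`. -/
theorem statement7 {Ω : Type*} [MeasurableSpace Ω] (Ps : Set (Measure Ω)) (hPs : Ps.Nonempty)
    (hprob : ∀ P ∈ Ps, IsProbabilityMeasure P) {d : ℕ}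
    (Vn : ℕ → Ω → Fin d → ℝ) (V : Ω → Fin d → ℝ)
    (hVn : ∀ n, Measurable (Vn n)) (hV : Measurable V)
    (hmom : ∃ B : ℝ, ∀ P ∈ Ps,
      ∫⁻ ω, ENNReal.ofReal (∑ j, (V ω j) ^ 2) ∂P ≤ ENNReal.ofReal B)
    (hcdf : ∀ t : Fin d → ℝ, ∀ ε > (0 : ℝ), ∃ n₀ : ℕ, ∀ n ≥ n₀, ∀ P ∈ Ps,
      |(P {ω | ∀ j, Vn n ω j ≤ t j}).toReal - (P {ω | ∀ j, V ω j ≤ t j}).toReal| ≤ ε) :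
    ∀ ε > (0 : ℝ), ∃ K : Set (Fin d → ℝ), IsCompact K ∧ ∃ n₀ : ℕ, ∀ n ≥ n₀, ∀ P ∈ Ps,
      (P {ω | Vn n ω ∉ K}).toReal < ε := by
  obtain ⟨B, hB⟩ := hmom
  intro ε hε
  have hd : (0 : ℝ) < 4 * ((d : ℝ) + 1) := by positivity
  obtain ⟨δ, hδdef⟩ : ∃ δ : ℝ, δ = ε / (4 * ((d : ℝ) + 1)) := ⟨_, rfl⟩
  have hδ : 0 < δ := by rw [hδdef]; positivity
  have hδε : 4 * ((d : ℝ) + 1) * δ = ε := by rw [hδdef]; field_simp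
  obtain ⟨M, hMdef⟩ : ∃ M : ℝ, M = max B 0 / δ + 1 := ⟨_, rfl⟩
  have hB0 : 0 ≤ max B 0 := le_max_right _ _
  have hM1 : 1 ≤ M := by
    rw [hMdef]; have : 0 ≤ max B 0 / δ := by positivity
    linarith
  have hMB : B ≤ δ * M ^ 2 := by
    have h1 : max B 0 ≤ δ * M := by
      rw [hMdef, mul_add, mul_div_cancel₀ _ hδ.ne']; linarith
    have h2 : M ≤ M ^ 2 := by nlinarith
    have h3 : δ * M ≤ δ * M ^ 2 := mul_le_mul_of_nonneg_left h2 hδ.le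
    linarith [le_max_left B 0]
  have hM2 : 0 < M ^ 2 := by positivity
  -- Markov's inequality
  have hmark : ∀ P ∈ Ps, P.real {ω | M ^ 2 ≤ ∑ j, (V ω j) ^ 2} ≤ δ := by
    intro P hP
    have := hprob P hP
    have hmeas : Measurable fun ω => ENNReal.ofReal (∑ j, (V ω j) ^ 2) := by fun_prop
    have h1 := (mul_meas_ge_le_lintegral (μ := P) hmeas (ENNReal.ofReal (M ^ 2))).trans (hB P hP)
    have h2 : ENNReal.ofReal (M ^ 2) * P {ω | M ^ 2 ≤ ∑ j, (V ω j) ^ 2}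
        ≤ ENNReal.ofReal (δ * M ^ 2) := by
      refine le_trans ?_ (h1.trans (ENNReal.ofReal_le_ofReal hMB))
      gcongr
      intro h
      exact ENNReal.ofReal_le_ofReal h
    have h3 := ENNReal.toReal_mono ENNReal.ofReal_ne_top h2
    rw [ENNReal.toReal_mul, ENNReal.toReal_ofReal hM2.le,
      ENNReal.toReal_ofReal (by positivity)] at h3
    change M ^ 2 * P.real _ ≤ _ at h3
    nlinarith
  have hsq : ∀ ω j, (V ω j) ^ 2 ≤ ∑ j, (V ω j) ^ 2 := fun ω j =>
    Finset.single_le_sum (f := fun j => (V ω j) ^ 2) (fun i _ => sq_nonneg _) (Finset.mem_univ j)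
  obtain ⟨n0, hn0⟩ := hcdf (fun _ => M) δ hδ
  choose m hm using fun j : Fin d => hcdf (Function.update (fun _ => M) j (-M)) δ hδ
  refine ⟨Set.Icc (fun _ => -M) (fun _ => M), isCompact_Icc, max n0 (Finset.univ.sup m), ?_⟩
  intro n hn P hP
  have := hprob P hP
  have hmk := hmark P hP
  have hup := abs_le.1 (hn0 n (le_trans (le_max_left _ _) hn) P hP)
  have hlo := fun j => abs_le.1 (hm j n
    (le_trans ((Finset.le_sup (Finset.mem_univ j)).trans (le_max_right _ _)) hn) P hP)
  have hmsV : ∀ W : Ω → Fin d → ℝ, Measurable W → ∀ t : Fin d → ℝ,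
      MeasurableSet {ω | ∀ j, W ω j ≤ t j} := by
    intro W hW t
    exact hW (measurableSet_Iic (a := t))
  have c1 : P.real {ω | ∀ j, V ω j ≤ M}ᶜ ≤ δ := by
    refine le_trans (measureReal_mono ?_) hmk
    intro ω hω
    simp only [Set.mem_compl_iff, Set.mem_setOf_eq, not_forall, not_le] at hω ⊢
    obtain ⟨j, hj⟩ := hω
    exact le_trans (by nlinarith) (hsq ω j)
  have c2 : ∀ j, P.real {ω | ∀ i, V ω i ≤ Function.update (fun _ => M) j (-M) i} ≤ δ := by
    intro j
    refine le_trans (measureReal_mono ?_) hmk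
    intro ω hω
    have h := hω j
    rw [Function.update_self] at h
    exact le_trans (by nlinarith) (hsq ω j)
  have e1 := probReal_compl_eq_one_sub (μ := P) (hmsV V hV fun _ => M)
  have e2 := probReal_compl_eq_one_sub (μ := P) (hmsV (Vn n) (hVn n) fun _ => M)
  have hsub : {ω | Vn n ω ∉ Set.Icc (fun _ => -M) (fun _ => M)} ⊆
      {ω | ∀ j, Vn n ω j ≤ M}ᶜ ∪
        ⋃ j, {ω | ∀ i, Vn n ω i ≤ Function.update (fun _ => M) j (-M) i} := by
    intro ω hω
    by_cases h : ∀ j, Vn n ω j ≤ M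
    · right
      have h' : ∃ j, Vn n ω j < -M := by
        by_contra! hc
        exact hω ⟨hc, h⟩
      obtain ⟨j, hj⟩ := h'
      refine Set.mem_iUnion.2 ⟨j, fun i => ?_⟩
      by_cases hij : i = j
      · subst hij; rw [Function.update_self]; exact hj.le
      · rw [Function.update_of_ne hij]; exact h i
    · left; exact h
  have hU : P.real (⋃ j, {ω | ∀ i, Vn n ω i ≤ Function.update (fun _ => M) j (-M) i})
      ≤ d * (2 * δ) := by
    refine (measureReal_iUnion_fintype_le _).trans ?_
    refine (Finset.sum_le_card_nsmul _ _ (2 * δ) ?_).trans (by simp)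
    intro j _
    have h1 := (hlo j).2
    have h2 := c2 j
    simp only [Measure.real] at h2 ⊢
    linarith
  have h1 : P.real {ω | ∀ j, Vn n ω j ≤ M}ᶜ ≤ 2 * δ := by
    have := hup.1
    simp only [Measure.real] at e1 e2 c1 ⊢
    linarith
  have htot := (measureReal_mono (μ := P) hsub).trans (measureReal_union_le _ _)
  change P.real _ < ε
  have hd0 : (0 : ℝ) ≤ d := Nat.cast_nonneg d
  nlinarith [mul_nonneg hd0 hδ.le]
end

section
/- Let W be a measurable random vector with values in ℝ^J on a probability space, and suppose E‖W‖² ≤ c for some c ≥ 0. Then for every real number r ≥ 2 and every integer m ≥ 1, E‖W‖^r ≤ c^{1 − 2^{−m}} · ( E‖W‖^{2^m (r−2) + 2} )^{2^{−m}}; in particular, E‖W‖^r is bounded by a constant depending only on m and c times the 2^{−m}-th power of the moment of order 2^m(r−2)+2. -/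
open MeasureTheory

/-- If `W` is an `ℝ^J`-valued measurable random vector with `E‖W‖² ≤ c`,
then for every real `r ≥ 2` and integer `m ≥ 1`,
`E‖W‖^r ≤ c^{1 − 2^{−m}} · (E‖W‖^{2^m (r−2) + 2})^{2^{−m}}`, the inequality being
interpreted in `[0, ∞]`. -/
theorem statement14 {Ω : Type*} [MeasurableSpace Ω] (P : Measure Ω) [IsProbabilityMeasure P]
    {J : ℕ} (W : Ω → EuclideanSpace ℝ (Fin J)) (hW : Measurable W)
    (c : ℝ) (hc : 0 ≤ c)
    (hmom : ∫⁻ ω, ENNReal.ofReal (‖W ω‖ ^ (2 : ℝ)) ∂P ≤ ENNReal.ofReal c)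
    (r : ℝ) (hr : 2 ≤ r) (m : ℕ) (hm : 1 ≤ m) :
    ∫⁻ ω, ENNReal.ofReal (‖W ω‖ ^ r) ∂P ≤
      ENNReal.ofReal c ^ (1 - ((2 : ℝ) ^ m)⁻¹) *
        (∫⁻ ω, ENNReal.ofReal (‖W ω‖ ^ ((2 : ℝ) ^ m * (r - 2) + 2)) ∂P) ^
          ((2 : ℝ) ^ m)⁻¹ := by
  have h1 : (1 : ℝ) ≤ 2 ^ m := one_le_pow₀ (by norm_num)
  have hpos : (0 : ℝ) < 2 ^ m := by positivity
  have ht0 : (0 : ℝ) ≤ ((2 : ℝ) ^ m)⁻¹ := by positivity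
  have ht1 : ((2 : ℝ) ^ m)⁻¹ ≤ 1 := inv_le_one_of_one_le₀ h1
  have hs : (0 : ℝ) ≤ 1 - ((2 : ℝ) ^ m)⁻¹ := by linarith
  have hq : (0 : ℝ) ≤ (2 : ℝ) ^ m * (r - 2) := mul_nonneg hpos.le (by linarith)
  have hH := ENNReal.lintegral_mul_norm_pow_le (μ := P)
    (f := fun ω => ENNReal.ofReal (‖W ω‖ ^ (2 : ℝ)))
    (g := fun ω => ENNReal.ofReal (‖W ω‖ ^ ((2 : ℝ) ^ m * (r - 2) + 2)))
    (hW.norm.pow_const _).ennreal_ofReal.aemeasurable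
    (hW.norm.pow_const _).ennreal_ofReal.aemeasurable hs ht0 (by ring)
  have hpt : ∀ ω, ENNReal.ofReal (‖W ω‖ ^ r) =
      ENNReal.ofReal (‖W ω‖ ^ (2 : ℝ)) ^ (1 - ((2 : ℝ) ^ m)⁻¹) *
      ENNReal.ofReal (‖W ω‖ ^ ((2 : ℝ) ^ m * (r - 2) + 2)) ^ ((2 : ℝ) ^ m)⁻¹ := by
    intro ω
    have hn := norm_nonneg (W ω)
    rw [ENNReal.ofReal_rpow_of_nonneg (by positivity) hs,
      ENNReal.ofReal_rpow_of_nonneg (by positivity) ht0,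
      ← ENNReal.ofReal_mul (by positivity), ← Real.rpow_mul hn, ← Real.rpow_mul hn,
      ← Real.rpow_add_of_nonneg hn (by positivity) (by positivity)]
    congr 2
    field_simp
    ring
  simp_rw [hpt]
  refine hH.trans ?_
  gcongr
end
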